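/- arXiv:math/0607564 — 2 statements merged into one kernel-verified Lean document; each statement's English description precedes it below -/
import Mathlib

section
/- Let α be a finite type with decidable equality and let S be a set of partial permutations of α (elements of PEquiv α α) that is closed under composition (PEquiv.trans) and under inversion (PEquiv.symm), and which is transitive: for all x, y ∈ α there is f ∈ S with f x = some y. Then the domains of the idempotents of S of minimal nonzero rank partition α: for every x ∈ α there exists a unique e ∈ S such that e.trans e = e, e has minimal nonzero rank (0 < rank e and rank e ≤ rank g for every g ∈ S with 0 < rank g), and (e x).isSome. -/
/-- The rank of a partial permutation: the number of points where it is defined. -/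
def pequivRank {α : Type*} [Fintype α] [DecidableEq α] (f : α ≃. α) : ℕ :=
  (Finset.univ.filter fun x => (f x).isSome).card

theorem pequivRank_pos {α : Type*} [Fintype α] [DecidableEq α] {f : α ≃. α} :
    0 < pequivRank f ↔ ∃ x y, f x = some y := by
  simp [pequivRank, Finset.card_pos, Finset.filter_nonempty_iff, Option.isSome_iff_exists]

theorem isSome_of_isSome_trans {α β γ : Type*} {f : α ≃. β} {g : β ≃. γ} {x : α}
    (h : (f.trans g x).isSome) : (f x).isSome := by
  obtain ⟨c, hc⟩ := Option.isSome_iff_exists.1 h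
  obtain ⟨b, hb, -⟩ := (PEquiv.trans_eq_some f g x c).1 hc
  simp [hb]

theorem pequivRank_trans_le_left {α : Type*} [Fintype α] [DecidableEq α] (f g : α ≃. α) :
    pequivRank (f.trans g) ≤ pequivRank f :=
  Finset.card_le_card <|
    Finset.monotone_filter_right _ fun _ _ => isSome_of_isSome_trans

theorem pequivRank_trans_le_right {α : Type*} [Fintype α] [DecidableEq α] (f g : α ≃. α) :
    pequivRank (f.trans g) ≤ pequivRank g := by
  have key : ∀ x, (f.trans g x).isSome → ∃ y, f x = some y ∧ (g y).isSome := by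
    intro x hx
    obtain ⟨c, hc⟩ := Option.isSome_iff_exists.1 hx
    obtain ⟨b, hb, hbc⟩ := (PEquiv.trans_eq_some f g x c).1 hc
    exact ⟨b, hb, by simp [hbc]⟩
  refine Finset.card_le_card_of_injOn (fun x => (f x).getD x) ?_ ?_
  · intro x hx
    obtain ⟨y, hy, hgy⟩ := key x (by simpa using hx)
    simpa [hy] using hgy
  · intro x hx x' hx' h
    obtain ⟨y, hy, -⟩ := key x (by simpa using hx)
    obtain ⟨y', hy', -⟩ := key x' (by simpa using hx')
    simp only [hy, hy', Option.getD_some] at h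
    subst h
    exact f.inj hy hy'

theorem eq_of_trans_self_eq {α : Type*} {e : α ≃. α} (he : e.trans e = e) {a b : α}
    (h : e a = some b) : a = b := by
  obtain ⟨c, hc, hcb⟩ := (PEquiv.trans_eq_some e e a b).1 (he.symm ▸ h)
  obtain rfl : c = b := Option.some.inj (hc.symm.trans h)
  exact e.inj h hcb

theorem apply_eq_some_self_iff_isSome {α : Type*} {e : α ≃. α} (he : e.trans e = e) {a : α} :
    e a = some a ↔ (e a).isSome := by
  refine ⟨fun h => by simp [h], fun h => ?_⟩
  obtain ⟨b, hb⟩ := Option.isSome_iff_exists.1 h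
  obtain rfl := eq_of_trans_self_eq he hb
  exact hb

theorem isSome_of_pequivRank_le_trans {α : Type*} [Fintype α] [DecidableEq α]
    {e e' : α ≃. α} (he : e.trans e = e) (hle : pequivRank e ≤ pequivRank (e.trans e'))
    {a : α} (ha : (e a).isSome) : (e' a).isSome := by
  have hdom := Finset.eq_of_subset_of_card_le
    (Finset.monotone_filter_right Finset.univ
      fun x _ => isSome_of_isSome_trans (f := e) (g := e') (x := x)) hle
  have hmem : (e.trans e' a).isSome := by
    have : a ∈ Finset.univ.filter fun x => (e.trans e' x).isSome := hdom ▸ by simpa using ha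
    simpa using this
  obtain ⟨c, hc⟩ := Option.isSome_iff_exists.1 hmem
  obtain ⟨b, hb, hbc⟩ := (PEquiv.trans_eq_some e e' a c).1 hc
  obtain rfl := eq_of_trans_self_eq he hb
  simp [hbc]

/-- In a transitive set of partial permutations closed under composition and inversion, the
domains of the idempotents of minimal nonzero rank partition the underlying set: every
point lies in the domain of exactly one such idempotent. -/
theorem domains_of_min_rank_idempotents_partition {α : Type*} [Fintype α] [DecidableEq α]
    (S : Set (α ≃. α))
    (htrans : ∀ f ∈ S, ∀ g ∈ S, f.trans g ∈ S)
    (hsymm : ∀ f ∈ S, f.symm ∈ S)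
    (htransitive : ∀ x y : α, ∃ f ∈ S, f x = some y)
    (x : α) :
    ∃! e : α ≃. α, e ∈ S ∧ e.trans e = e ∧ 0 < pequivRank e ∧
      (∀ g ∈ S, 0 < pequivRank g → pequivRank e ≤ pequivRank g) ∧
      (e x).isSome := by
  have unique : ∀ e e' : α ≃. α, e ∈ S → e' ∈ S → e.trans e = e → e'.trans e' = e' →
      (∀ g ∈ S, 0 < pequivRank g → pequivRank e ≤ pequivRank g) →
      (e x).isSome → (e' x).isSome → ∀ a, (e a).isSome → (e' a).isSome := by
    intro e e' heS heS' he he' hmin hx hx' a ha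
    refine isSome_of_pequivRank_le_trans he (hmin _ (htrans e heS e' heS') ?_) ha
    exact pequivRank_pos.2 ⟨x, x, (PEquiv.trans_eq_some e e' x x).2
      ⟨x, (apply_eq_some_self_iff_isSome he).2 hx, (apply_eq_some_self_iff_isSome he').2 hx'⟩⟩
  refine existsUnique_of_exists_of_unique ?_ ?_
  · obtain ⟨f₀, hf₀, hf₀x⟩ := htransitive x x
    obtain ⟨m, ⟨hmS, hm⟩, hmin⟩ := exists_minimalFor_of_wellFoundedLT
      (fun f => f ∈ S ∧ 0 < pequivRank f) pequivRank ⟨f₀, hf₀, pequivRank_pos.2 ⟨x, x, hf₀x⟩⟩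
    obtain ⟨z, w, hzw⟩ := pequivRank_pos.1 hm
    obtain ⟨f, hfS, hf⟩ := htransitive x z
    have hgS : f.trans m ∈ S := htrans f hfS m hmS
    have hg : f.trans m x = some w := (PEquiv.trans_eq_some f m x w).2 ⟨z, hf, hzw⟩
    have hex : (f.trans m).trans (f.trans m).symm x = some x :=
      (PEquiv.trans_eq_some _ _ x x).2 ⟨w, hg, (PEquiv.eq_some_iff _).2 hg⟩
    refine ⟨(f.trans m).trans (f.trans m).symm,
      htrans _ hgS _ (hsymm _ hgS), ?_, pequivRank_pos.2 ⟨x, x, hex⟩, fun g hgS hg => ?_,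
      by simp [hex]⟩
    · rw [PEquiv.self_trans_symm]
      ext a b
      simp only [PEquiv.trans_eq_some, PEquiv.ofSet_eq_some_iff]
      constructor
      · rintro ⟨c, ⟨rfl, hc⟩, rfl, -⟩
        exact ⟨rfl, hc⟩
      · rintro ⟨rfl, hb⟩
        exact ⟨b, ⟨rfl, hb⟩, rfl, hb⟩
    · have hmg : pequivRank m ≤ pequivRank g := (le_total _ _).elim id (hmin ⟨hgS, hg⟩)
      exact ((pequivRank_trans_le_left _ _).trans (pequivRank_trans_le_right f m)).trans hmg
  · rintro e e' ⟨heS, he, -, hmin, hx⟩ ⟨heS', he', -, hmin', hx'⟩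
    have hdom : ∀ a, (e a).isSome ↔ (e' a).isSome := fun a =>
      ⟨unique e e' heS heS' he he' hmin hx hx' a, unique e' e heS' heS he' he hmin' hx' hx a⟩
    ext a b
    constructor
    · intro h
      obtain rfl := eq_of_trans_self_eq he h
      exact (apply_eq_some_self_iff_isSome he').2 ((hdom a).1 (Option.isSome_of_mem h))
    · intro h
      obtain rfl := eq_of_trans_self_eq he' h
      exact (apply_eq_some_self_iff_isSome he).2 ((hdom a).2 (Option.isSome_of_mem h))
end

section
/- Let M be a finite inverse monoid and let T be a finite set of idempotents of M containing exactly one representative from each isomorphism class of idempotents, where idempotents e and f are isomorphic if there exists u ∈ M with u * inv u = e and inv u * u = f. Then the cardinality of M equals Σ_{e ∈ T} n_e² · |G_e|, where n_e is the number of idempotents of M isomorphic to e and G_e = {s ∈ M | s * inv s = e and inv s * s = e} is the maximal subgroup at e. -/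
namespace InverseMonoid

/-- The arrow relation of the groupoid of a monoid with generalized inverses: `s` is an arrow
from `e` to `f` if `s * inv s = e` and `inv s * s = f`. -/
def IsArrow {M : Type*} [Monoid M] (inv : M → M) (e s f : M) : Prop :=
  s * inv s = e ∧ inv s * s = f

section

variable {M : Type*} [Monoid M] {inv : M → M}

theorem eq_of_generalized_inverses
    (hcomm : ∀ e f : M, e * e = e → f * f = f → e * f = f * e) {a x y : M}
    (hx₁ : a * x * a = a) (hx₂ : x * a * x = x) (hy₁ : a * y * a = a) (hy₂ : y * a * y = y) :
    x = y := by
  have hl : x * a * (y * a) = y * a * (x * a) :=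
    hcomm _ _ (by rw [← mul_assoc, hx₂]) (by rw [← mul_assoc, hy₂])
  have hr : a * x * (a * y) = a * y * (a * x) :=
    hcomm _ _ (by rw [← mul_assoc, hx₁]) (by rw [← mul_assoc, hy₁])
  calc x = x * (a * y * a) * x := by rw [hy₁, hx₂]
    _ = x * a * (y * a) * x := by simp only [mul_assoc]
    _ = y * a * (x * a * x) := by rw [hl]; simp only [mul_assoc]
    _ = y * (a * y * a) * x := by rw [hx₂, hy₁]
    _ = y * (a * y * (a * x)) := by simp only [mul_assoc]
    _ = y * (a * x * a) * y := by rw [← hr]; simp only [mul_assoc]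
    _ = y := by rw [hx₁, hy₂]

theorem inv_inv
    (hinv1 : ∀ s : M, s * inv s * s = s) (hinv2 : ∀ s : M, inv s * s * inv s = inv s)
    (hcomm : ∀ e f : M, e * e = e → f * f = f → e * f = f * e) (s : M) :
    inv (inv s) = s :=
  eq_of_generalized_inverses hcomm (hinv1 _) (hinv2 _) (hinv2 s) (hinv1 s)

theorem inv_mul
    (hinv1 : ∀ s : M, s * inv s * s = s) (hinv2 : ∀ s : M, inv s * s * inv s = inv s)
    (hcomm : ∀ e f : M, e * e = e → f * f = f → e * f = f * e) (s t : M) :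
    inv (s * t) = inv t * inv s := by
  have h : t * inv t * (inv s * s) = inv s * s * (t * inv t) :=
    hcomm _ _ (by rw [← mul_assoc, hinv1]) (by rw [← mul_assoc, hinv2])
  refine eq_of_generalized_inverses hcomm (hinv1 _) (hinv2 _) ?_ ?_
  · calc s * t * (inv t * inv s) * (s * t) = s * (t * inv t * (inv s * s)) * t := by
          simp only [mul_assoc]
      _ = s * inv s * s * (t * inv t * t) := by rw [h]; simp only [mul_assoc]
      _ = s * t := by rw [hinv1, hinv1]
  · calc inv t * inv s * (s * t) * (inv t * inv s)
        = inv t * (inv s * s * (t * inv t)) * inv s := by simp only [mul_assoc]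
      _ = inv t * t * inv t * (inv s * s * inv s) := by rw [← h]; simp only [mul_assoc]
      _ = inv t * inv s := by rw [hinv2, hinv2]

theorem IsArrow.mul_right (hinv1 : ∀ s : M, s * inv s * s = s) {e s f : M}
    (h : IsArrow inv e s f) : s * f = s := by
  rw [← h.2, ← mul_assoc, hinv1]

theorem IsArrow.mul_left (hinv1 : ∀ s : M, s * inv s * s = s) {e s f : M}
    (h : IsArrow inv e s f) : e * s = s := by
  rw [← h.1, hinv1]

theorem IsArrow.symm
    (hinv1 : ∀ s : M, s * inv s * s = s) (hinv2 : ∀ s : M, inv s * s * inv s = inv s)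
    (hcomm : ∀ e f : M, e * e = e → f * f = f → e * f = f * e) {e s f : M}
    (h : IsArrow inv e s f) : IsArrow inv f (inv s) e := by
  rw [IsArrow, inv_inv hinv1 hinv2 hcomm]
  exact ⟨h.2, h.1⟩

theorem IsArrow.comp
    (hinv1 : ∀ s : M, s * inv s * s = s) (hinv2 : ∀ s : M, inv s * s * inv s = inv s)
    (hcomm : ∀ e f : M, e * e = e → f * f = f → e * f = f * e) {e s f t g : M}
    (hs : IsArrow inv e s f) (ht : IsArrow inv f t g) : IsArrow inv e (s * t) g := by
  rw [IsArrow, inv_mul hinv1 hinv2 hcomm]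
  constructor
  · calc s * t * (inv t * inv s) = s * (t * inv t) * inv s := by simp only [mul_assoc]
      _ = e := by rw [ht.1, hs.mul_right hinv1, hs.1]
  · calc inv t * inv s * (s * t) = inv t * (inv s * s * t) := by simp only [mul_assoc]
      _ = g := by rw [hs.2, ht.mul_left hinv1, ht.2]

theorem mul_inv_idem (hinv1 : ∀ s : M, s * inv s * s = s) (s : M) :
    s * inv s * (s * inv s) = s * inv s := by
  rw [← mul_assoc, hinv1]

theorem inv_mul_idem (hinv2 : ∀ s : M, inv s * s * inv s = inv s) (s : M) :
    inv s * s * (inv s * s) = inv s * s := by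
  rw [← mul_assoc, hinv2]

/-- The arrows in the connected component of `e` correspond to triples consisting of the
source, the target, and an element of the maximal subgroup at `e`. -/
theorem card_component
    (hinv1 : ∀ s : M, s * inv s * s = s) (hinv2 : ∀ s : M, inv s * s * inv s = inv s)
    (hcomm : ∀ e f : M, e * e = e → f * f = f → e * f = f * e) (e : M) :
    Nat.card {s : M // ∃ u, IsArrow inv (s * inv s) u e} =
      (Nat.card {f : M // f * f = f ∧ ∃ u, IsArrow inv e u f}) ^ 2 *
        Nat.card {s : M // IsArrow inv e s e} := by
  choose p hp using fun f : {f : M // f * f = f ∧ ∃ u, IsArrow inv e u f} => f.2.2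
  have symm {e s f : M} (h : IsArrow inv e s f) := h.symm hinv1 hinv2 hcomm
  have comp {e s f t g : M} (hs : IsArrow inv e s f) (ht : IsArrow inv f t g) :=
    hs.comp hinv1 hinv2 hcomm ht
  have arr (s : M) : IsArrow inv (s * inv s) s (inv s * s) := ⟨rfl, rfl⟩
  let N := {f : M // f * f = f ∧ ∃ u, IsArrow inv e u f}
  let src (s : {s : M // ∃ u, IsArrow inv (s * inv s) u e}) : N :=
    ⟨s * inv s, mul_inv_idem hinv1 _, s.2.imp' inv fun _ hu => symm hu⟩
  let tgt (s : {s : M // ∃ u, IsArrow inv (s * inv s) u e}) : N :=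
    ⟨inv s * s, inv_mul_idem hinv2 _, s.2.imp' (fun u => inv u * s) fun _ hu =>
      comp (symm hu) (arr _)⟩
  have back (x : (N × N) × {s : M // IsArrow inv e s e}) :
      IsArrow inv x.1.1 (inv (p x.1.1) * x.2 * p x.1.2) x.1.2 :=
    comp (comp (symm (hp _)) x.2.2) (hp _)
  let E : {s : M // ∃ u, IsArrow inv (s * inv s) u e} ≃
      (N × N) × {s : M // IsArrow inv e s e} :=
    { toFun s := ((src s, tgt s), ⟨p (src s) * s * inv (p (tgt s)),
        comp (comp (hp (src s)) (arr s)) (symm (hp (tgt s)))⟩)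
      invFun x := ⟨inv (p x.1.1) * x.2 * p x.1.2, inv (p x.1.1), by
        rw [(back x).1]; exact symm (hp _)⟩
      left_inv s := by
        apply Subtype.ext
        calc inv (p (src s)) * (p (src s) * s * inv (p (tgt s))) * p (tgt s)
            = inv (p (src s)) * p (src s) * s * (inv (p (tgt s)) * p (tgt s)) := by
              simp only [mul_assoc]
          _ = s := by
            rw [(hp (src s)).2, (hp (tgt s)).2, (arr s.1).mul_left hinv1,
              (arr s.1).mul_right hinv1]
      right_inv x := by
        have h₁ := Subtype.ext (a1 := src ⟨_, _, by
          rw [(back x).1]; exact symm (hp _)⟩) (a2 := x.1.1) (back x).1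
        have h₂ := Subtype.ext (a1 := tgt ⟨_, _, by
          rw [(back x).1]; exact symm (hp _)⟩) (a2 := x.1.2) (back x).2
        refine Prod.ext (Prod.ext h₁ h₂) (Subtype.ext ?_)
        dsimp only
        rw [h₁, h₂]
        calc p x.1.1 * (inv (p x.1.1) * x.2 * p x.1.2) * inv (p x.1.2)
            = p x.1.1 * inv (p x.1.1) * x.2 * (p x.1.2 * inv (p x.1.2)) := by
              simp only [mul_assoc]
          _ = x.2 := by
            rw [(hp x.1.1).1, (hp x.1.2).1, x.2.2.mul_left hinv1, x.2.2.mul_right hinv1] }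
  rw [Nat.card_congr E, Nat.card_prod, Nat.card_prod, sq]

end

end InverseMonoid

open InverseMonoid in

/-- The cardinality of a finite inverse monoid is `∑ n_e² * |G_e|`, where `e` ranges over a
transversal `T` of the isomorphism classes of idempotents, `n_e` is the number of
idempotents isomorphic to `e`, and `G_e` is the maximal subgroup at `e`. -/
theorem card_inverse_monoid_eq_sum {M : Type*} [Monoid M] [Fintype M]
    (inv : M → M)
    (hinv1 : ∀ s : M, s * inv s * s = s)
    (hinv2 : ∀ s : M, inv s * s * inv s = inv s)
    (hcomm : ∀ e f : M, e * e = e → f * f = f → e * f = f * e)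
    (T : Finset M)
    (hT1 : ∀ e ∈ T, e * e = e)
    (hT2 : ∀ f : M, f * f = f →
      ∃! e : M, e ∈ T ∧ ∃ u : M, u * inv u = f ∧ inv u * u = e) :
    Nat.card M = ∑ e ∈ T,
      (Nat.card {f : M // f * f = f ∧ ∃ u : M, u * inv u = e ∧ inv u * u = f}) ^ 2 *
        Nat.card {s : M // s * inv s = e ∧ inv s * s = e} := by
  classical
  choose r hr huniq using fun s : M => hT2 (s * inv s) (mul_inv_idem hinv1 s)
  rw [Nat.card_eq_fintype_card, ← Finset.card_univ,
    Finset.card_eq_sum_card_fiberwise (f := r) (t := T) fun s _ => (hr s).1]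
  refine Finset.sum_congr rfl fun e he => ?_
  refine Eq.trans ?_ (card_component hinv1 hinv2 hcomm e)
  rw [Nat.card_eq_fintype_card, Fintype.card_subtype]
  congr 1
  ext s
  simp only [Finset.mem_filter, Finset.mem_univ, true_and]
  exact ⟨fun h => h ▸ (hr s).2, fun h => (huniq s e ⟨he, h⟩).symm⟩
end
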